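/- For every quantified Boolean formula φ = ∃x₁∀x₂∃x₃⋯∀x_{2r} (C₁ ∧ ⋯ ∧ C_m) in prenex normal form with clauses of three literals, the coalition has a winning strategy from v₀ in the parameterized safety game G_φ if and only if φ is true. -/

import Mathlib

/-- The prefix of length `k` of an infinite word `w`. -/
def wordPrefix {A : Type*} (w : ℕ → A) (k : ℕ) : List A := (List.range k).map w

/-- The history `ρ 0, ρ 1, …, ρ j` of a play `ρ`. -/
def histUpTo {V : Type*} (ρ : ℕ → V) (j : ℕ) : List V := (List.range (j+1)).map ρ

/-- `h` is a history from `v₀`: nonempty, starts at `v₀`, and consecutive vertices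
are linked by a nonempty transition language. -/
def IsHist {V A : Type*} (Δ : V → V → Set (List A)) (v₀ : V) (h : List V) : Prop :=
  h ≠ [] ∧ h.head? = some v₀ ∧ List.Chain' (fun u w => (Δ u w).Nonempty) h

/-- Membership of the play `ρ` in the `k`-outcome of the coalition strategy `σ` from `v₀`. -/
def InOutcome {V A : Type*} (Δ : V → V → Set (List A)) (v₀ : V) (σ : List V → ℕ → A)
    (k : ℕ) (ρ : ℕ → V) : Prop :=
  ρ 0 = v₀ ∧ ∀ j : ℕ, wordPrefix (σ (histUpTo ρ j)) k ∈ Δ (ρ j) (ρ (j+1))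

/-- The coalition strategy `σ` is winning from `v₀` for the safe set `S`. -/
def WinningFrom {V A : Type*} (Δ : V → V → Set (List A)) (S : Set V) (v₀ : V)
    (σ : List V → ℕ → A) : Prop :=
  ∀ k : ℕ, 1 ≤ k → ∀ ρ : ℕ → V, InOutcome Δ v₀ σ k ρ → ∀ j : ℕ, ρ j ∈ S

/-- Auxiliary loop-erasure on reversed histories (most recent vertex first). -/
def zipAux {V : Type*} [DecidableEq V] : List V → List V
  | [] => []
  | v' :: rest =>
    let z := zipAux rest
    if v' ∈ z then z.dropWhile (fun x => decide (x ≠ v')) else v' :: z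

/-- The loop-erasure map `zip` on histories. -/
def zip {V : Type*} [DecidableEq V] (h : List V) : List V := (zipAux h.reverse).reverse

/-- All words of the transition languages are nonempty. -/
def NonemptyWords {V A : Type*} (Δ : V → V → Set (List A)) : Prop :=
  ∀ v w : V, ∀ u ∈ Δ v w, u ≠ ([] : List A)

/-- Completeness of the arena. -/
def CompleteArena {V A : Type*} (Δ : V → V → Set (List A)) : Prop :=
  ∀ v : V, ∀ u : List A, u ≠ [] → ∃ w : V, u ∈ Δ v w

/-- Every unsafe vertex is a sink. -/
def UnsafeSinks {V A : Type*} (Δ : V → V → Set (List A)) (S : Set V) : Prop :=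
  ∀ v ∉ S, Δ v v = {u : List A | u ≠ []} ∧ ∀ w : V, w ≠ v → Δ v w = (∅ : Set (List A))

/-- A language of finite words is regular if it is accepted by a DFA with finitely
many states. -/
def IsRegularLang {A : Type*} (L : Set (List A)) : Prop :=
  ∃ (Q : Type) (_ : Fintype Q) (M : DFA A Q), ∀ u : List A, u ∈ M.accepts ↔ u ∈ L

/-- The strategy `σ` uses the memory set `M`. -/
def UsesMemory {V A : Type*} (Δ : V → V → Set (List A)) (v₀ : V)
    (σ : List V → ℕ → A) (M : Type) : Prop :=
  ∃ (minit : M) (upd : M → V → M) (next : M → V → ℕ → A),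
    ∀ h : List V, IsHist Δ v₀ h → σ h = next (h.tail.foldl upd minit) (h.getLastD v₀)

/-- The alphabet `Σ = {a, b, c, a_1, …, a_{2r}}` of the game `G_φ`
(`idx i` is the letter `a_{i+1}`). -/
inductive QA (r : ℕ) : Type where
  | a : QA r
  | b : QA r
  | c : QA r
  | idx (i : Fin (2 * r)) : QA r
deriving DecidableEq

/-- Vertices of `G_φ` (0-based indexing; `v j` is `v_j` for `0 ≤ j ≤ 2r-1`, `vx i` is
`vx_{i+1}`, `vxbar i` is `vx̄_{i+1}`, `vC h` is `vC_{h+1}`; the identifications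
`v_{2r} = vC_1` and `vC_{m+1} = ⊤` are built in). -/
inductive QV (r m : ℕ) : Type where
  | v (j : Fin (2 * r)) : QV r m
  | vx (i : Fin (2 * r)) : QV r m
  | vxbar (i : Fin (2 * r)) : QV r m
  | vC (h : Fin m) : QV r m
  | top : QV r m
  | bot : QV r m
deriving DecidableEq

/-- The `(i+1)`-st prime number (`Nat.nth Nat.Prime 0 = 2`). -/
noncomputable def prm (i : ℕ) : ℕ := Nat.nth Nat.Prime i

/-- `Σ⁺` over `QA r`. -/
def qSigPlus (r : ℕ) : Set (List (QA r)) := {u | u ≠ []}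

/-- The language of the literal `p = (i, pol)`: `{a_{i+1}^n : n ∈ M_{i+1}}` if `pol` is
true (literal `x_{i+1}`), and `{a_{i+1}^n : n ≥ 1, n ∉ M_{i+1}}` if `pol` is false
(literal `¬x_{i+1}`). -/
def litLang (r : ℕ) (p : Fin (2 * r) × Bool) : Set (List (QA r)) :=
  {u | ∃ n : ℕ, 1 ≤ n ∧ (prm p.1.val ∣ n ↔ p.2 = true) ∧
        u = List.replicate n (QA.idx p.1)}

/-- The explicitly specified transitions of `G_φ`, for `φ` with `2r` variables and `m`
clauses whose literals are given by `lit` (`lit h j = (i, pol)` meaning the `(j+1)`-st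
literal of clause `C_{h+1}` is `x_{i+1}` if `pol` and `¬x_{i+1}` otherwise). -/
noncomputable def qbfMain (r m : ℕ) (lit : Fin m → Fin 3 → Fin (2 * r) × Bool) :
    QV r m → QV r m → Set (List (QA r))
  | QV.v j, QV.vx i =>
      if i = j then
        (if j.val % 2 = 0 then
          {u | ∃ n : ℕ, 1 ≤ n ∧ prm j.val ∣ n ∧ u = List.replicate n QA.a}
        else
          {u | ∃ n : ℕ, 1 ≤ n ∧ prm j.val ∣ n ∧ u = List.replicate n QA.c})
      else ∅
  | QV.v j, QV.vxbar i =>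
      if i = j then
        (if j.val % 2 = 0 then
          {u | ∃ n : ℕ, 1 ≤ n ∧ ¬ prm j.val ∣ n ∧ u = List.replicate n QA.b}
        else
          {u | ∃ n : ℕ, 1 ≤ n ∧ ¬ prm j.val ∣ n ∧ u = List.replicate n QA.c})
      else ∅
  | QV.v j, QV.top =>
      if j.val % 2 = 0 then
        {u | ∃ n : ℕ, 1 ≤ n ∧ ¬ prm j.val ∣ n ∧ u = List.replicate n QA.a} ∪
        {u | ∃ n : ℕ, 1 ≤ n ∧ prm j.val ∣ n ∧ u = List.replicate n QA.b}
      else ∅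
  | QV.vx i, QV.v j => if j.val = i.val + 1 then qSigPlus r else ∅
  | QV.vxbar i, QV.v j => if j.val = i.val + 1 then qSigPlus r else ∅
  | QV.vx i, QV.vC h => if i.val = 2 * r - 1 ∧ h.val = 0 then qSigPlus r else ∅
  | QV.vxbar i, QV.vC h => if i.val = 2 * r - 1 ∧ h.val = 0 then qSigPlus r else ∅
  | QV.vC h, QV.vC h' =>
      if h'.val = h.val + 1 then ⋃ jj : Fin 3, litLang r (lit h jj) else ∅
  | QV.vC h, QV.top =>
      if h.val = m - 1 then ⋃ jj : Fin 3, litLang r (lit h jj) else ∅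
  | QV.top, QV.top => qSigPlus r
  | QV.bot, QV.bot => qSigPlus r
  | _, _ => ∅

/-- The transition function of `G_φ`: every nonempty word not covered by the specified
transitions leads from any vertex `v ≠ ⊥` to `⊥`. -/
noncomputable def qbfDelta (r m : ℕ) (lit : Fin m → Fin 3 → Fin (2 * r) × Bool) :
    QV r m → QV r m → Set (List (QA r)) := fun v w =>
  if v ≠ QV.bot ∧ w = QV.bot then
    {u | u ≠ [] ∧ ∀ w' : QV r m, u ∉ qbfMain r m lit v w'}
  else qbfMain r m lit v w

/-- The safe set of `G_φ`: everything but `⊥`. -/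
def qbfSafe (r m : ℕ) : Set (QV r m) := {v | v ≠ QV.bot}

/-- The valuation `ι` satisfies the matrix `C₁ ∧ ⋯ ∧ C_m`. -/
def SatisfiesMatrix (r m : ℕ) (lit : Fin m → Fin 3 → Fin (2 * r) × Bool)
    (ι : Fin (2 * r) → Bool) : Prop :=
  ∀ h : Fin m, ∃ j : Fin 3, ι (lit h j).1 = (lit h j).2

/-- Alternating quantification: starting from the partial assignment `bs`, quantify the
next `k` boolean variables, existentially at even (0-based) positions (the variables
`x₁, x₃, …`) and universally at odd positions (`x₂, x₄, …`), and then require `P`. -/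
def altTrue (P : List Bool → Prop) : ℕ → List Bool → Prop
  | 0, bs => P bs
  | k + 1, bs =>
      if bs.length % 2 = 0 then ∃ bv : Bool, altTrue P k (bs ++ [bv])
      else ∀ bv : Bool, altTrue P k (bs ++ [bv])

/-- Truth of `φ = ∃x₁∀x₂⋯∀x_{2r} (C₁ ∧ ⋯ ∧ C_m)`. -/
def qbfTrue (r m : ℕ) (lit : Fin m → Fin 3 → Fin (2 * r) × Bool) : Prop :=
  altTrue (fun bs => SatisfiesMatrix r m lit (fun i => bs.getD i.val false)) (2 * r) []

/-- `Reach Δ v₀ σ k h v`: the history `h`, ending in `v`, is compatible with the strategy `σ`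
played by `k` agents. -/
inductive Reach {V A : Type*} (Δ : V → V → Set (List A)) (v₀ : V) (σ : List V → ℕ → A)
    (k : ℕ) : List V → V → Prop
  | start : Reach Δ v₀ σ k [v₀] v₀
  | step {h : List V} {v w : V} (hr : Reach Δ v₀ σ k h v)
      (hw : wordPrefix (σ h) k ∈ Δ v w) : Reach Δ v₀ σ k (h ++ [w]) w

section Words

variable {A : Type*}

theorem length_wordPrefix (w : ℕ → A) (k : ℕ) : (wordPrefix w k).length = k := by
  simp [wordPrefix]

theorem wordPrefix_ne_nil (w : ℕ → A) {k : ℕ} (hk : 1 ≤ k) : wordPrefix w k ≠ [] := by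
  intro h
  have := length_wordPrefix w k
  rw [h] at this
  simp at this
  omega

theorem wordPrefix_const (x : A) (k : ℕ) : wordPrefix (fun _ => x) k = List.replicate k x := by
  simp [wordPrefix]

theorem wordPrefix_eq_replicate {w : ℕ → A} {k n : ℕ} {x : A} (hk : 1 ≤ k)
    (h : wordPrefix w k = List.replicate n x) : k = n ∧ w 0 = x := by
  have hl : k = n := by simpa [length_wordPrefix] using congrArg List.length h
  refine ⟨hl, ?_⟩
  subst hl
  have h0 := congrArg (fun l => l[0]?) h
  obtain ⟨k, rfl⟩ := Nat.exists_eq_add_of_le' hk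
  simpa [wordPrefix] using h0

end Words

section Plays

variable {V A : Type*} {Δ : V → V → Set (List A)} {v₀ : V} {σ : List V → ℕ → A} {k : ℕ}

theorem histUpTo_succ (ρ : ℕ → V) (j : ℕ) : histUpTo ρ (j + 1) = histUpTo ρ j ++ [ρ (j + 1)] := by
  simp [histUpTo, List.range_succ]

theorem histUpTo_congr {ρ ρ' : ℕ → V} {j : ℕ} (h : ∀ i ≤ j, ρ i = ρ' i) :
    histUpTo ρ j = histUpTo ρ' j := by
  refine List.map_congr_left fun i hi => h i ?_
  simp at hi
  omega

theorem InOutcome.reach {ρ : ℕ → V} (h : InOutcome Δ v₀ σ k ρ) (j : ℕ) :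
    Reach Δ v₀ σ k (histUpTo ρ j) (ρ j) := by
  induction j with
  | zero =>
    have h0 : histUpTo ρ 0 = [v₀] := by simp [histUpTo, h.1]
    rw [h0, h.1]
    exact .start
  | succ j ih =>
    rw [histUpTo_succ]
    exact .step ih (h.2 j)

theorem Reach.exists_play {h : List V} {v : V} (hr : Reach Δ v₀ σ k h v) :
    ∃ (ρ : ℕ → V) (n : ℕ), ρ 0 = v₀ ∧
      (∀ j < n, wordPrefix (σ (histUpTo ρ j)) k ∈ Δ (ρ j) (ρ (j + 1))) ∧
      histUpTo ρ n = h ∧ ∀ j, n ≤ j → ρ j = v := by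
  induction hr with
  | start => exact ⟨fun _ => v₀, 0, rfl, by simp, by simp [histUpTo], by simp⟩
  | @step h v w _ hw ih =>
    obtain ⟨ρ, n, h0, hs, hh, hv⟩ := ih
    let ρ' : ℕ → V := fun j => if j ≤ n then ρ j else w
    have hle : ∀ i ≤ n, ρ' i = ρ i := fun i hi => by simp [ρ', hi]
    have hgt : ∀ i, n < i → ρ' i = w := fun i hi => by simp [ρ', Nat.not_le.mpr hi]
    have hcongr : ∀ j ≤ n, histUpTo ρ' j = histUpTo ρ j := fun j hj =>
      histUpTo_congr fun i hi => hle i (hi.trans hj)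
    refine ⟨ρ', n + 1, by rw [hle 0 (Nat.zero_le _), h0], fun j hj => ?_, ?_,
      fun j hj => hgt j hj⟩
    · rw [hcongr j (by omega), hle j (by omega)]
      rcases Nat.lt_succ_iff_lt_or_eq.mp hj with hj | rfl
      · rw [hle (j + 1) hj]
        exact hs j hj
      · rw [hgt _ (Nat.lt_succ_self _), hh, hv _ le_rfl]
        exact hw
    · rw [histUpTo_succ, hcongr n le_rfl, hh, hgt _ (Nat.lt_succ_self _)]

/-- When every unsafe vertex loops on all nonempty words, a winning strategy is one under which
no unsafe vertex is reachable. -/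
theorem winningFrom_iff_reach {S : Set V} (hS : ∀ v ∉ S, ∀ u : List A, u ≠ [] → u ∈ Δ v v) :
    WinningFrom Δ S v₀ σ ↔ ∀ k, 1 ≤ k → ∀ h v, Reach Δ v₀ σ k h v → v ∈ S := by
  refine ⟨fun H k hk h v hr => ?_, fun H k hk ρ hρ j => H k hk _ _ (hρ.reach j)⟩
  by_contra hv
  obtain ⟨ρ, n, h0, hs, -, hn⟩ := hr.exists_play
  refine hv (hn n le_rfl ▸ H k hk ρ ⟨h0, fun j => ?_⟩ n)
  rcases lt_or_ge j n with hj | hj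
  · exact hs j hj
  · rw [hn j hj, hn (j + 1) (by omega)]
    exact hS v hv _ (wordPrefix_ne_nil _ hk)

theorem Reach.getLast?_eq {h : List V} {v : V} (hr : Reach Δ v₀ σ k h v) :
    h.getLast? = some v := by
  cases hr <;> simp

end Plays

section Primes

theorem prm_prime (i : ℕ) : (prm i).Prime := Nat.prime_nth_prime i

theorem prm_injective : Function.Injective prm :=
  Nat.nth_injective Nat.infinite_setOfPred_prime

theorem exists_prm_dvd_iff (n : ℕ) (s : ℕ → Prop) :
    ∃ k, 1 ≤ k ∧ ∀ i < n, prm i ∣ k ↔ s i := by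
  classical
  refine ⟨∏ i ∈ (Finset.range n).filter s, prm i,
    Nat.one_le_iff_ne_zero.mpr (Finset.prod_ne_zero_iff.mpr fun i _ => (prm_prime i).ne_zero),
    fun i hi => ?_⟩
  rw [(prm_prime i).prime.dvd_finsetProd_iff]
  constructor
  · rintro ⟨j, hj, hd⟩
    rw [prm_injective ((Nat.prime_dvd_prime_iff_eq (prm_prime i) (prm_prime j)).mp hd)]
    exact (Finset.mem_filter.mp hj).2
  · exact fun h => ⟨i, by simp [hi, h], dvd_rfl⟩

/-- The truth values of the first `j` variables encoded by the number `k` of agents. -/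
noncomputable def primeBits (k j : ℕ) : List Bool :=
  (List.range j).map fun i => decide (prm i ∣ k)

theorem length_primeBits (k j : ℕ) : (primeBits k j).length = j := by simp [primeBits]

theorem primeBits_succ (k j : ℕ) :
    primeBits k (j + 1) = primeBits k j ++ [decide (prm j ∣ k)] := by
  simp [primeBits, List.range_succ]

theorem getD_primeBits {k j i : ℕ} (hi : i < j) :
    (primeBits k j).getD i false = decide (prm i ∣ k) := by
  simp [primeBits, hi]

theorem exists_primeBits_eq (bs : List Bool) : ∃ k, 1 ≤ k ∧ primeBits k bs.length = bs := by
  obtain ⟨k, hk, h⟩ := exists_prm_dvd_iff bs.length (fun i => bs.getD i false = true)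
  refine ⟨k, hk, List.ext_getElem (length_primeBits _ _) fun i h₁ h₂ => ?_⟩
  have := h i h₂
  simp only [primeBits, List.getElem_map, List.getElem_range, this]
  simp [h₂]

end Primes

section Game

variable {r m : ℕ} {lit : Fin m → Fin 3 → Fin (2 * r) × Bool}

/-- The vertex `vx_{i+1}` or `vx̄_{i+1}`, according to the truth value `b`. -/
def varVertex (i : Fin (2 * r)) (b : Bool) : QV r m := if b then QV.vx i else QV.vxbar i

/-- The vertex `v_j` for `j ≤ 2r`, where `v_{2r} = vC_1`. -/
def stageVertex (hm : 1 ≤ m) (j : ℕ) : QV r m :=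
  if h : j < 2 * r then QV.v ⟨j, h⟩ else QV.vC ⟨0, hm⟩

theorem mem_qbfMain_varVertex (hm : 1 ≤ m) {i : Fin (2 * r)} {b : Bool} {w : QV r m}
    {u : List (QA r)} :
    u ∈ qbfMain r m lit (varVertex i b) w ↔ u ≠ [] ∧ w = stageVertex hm (i + 1) := by
  have hi := i.isLt
  unfold varVertex stageVertex
  cases b <;> cases w <;> simp only [qbfMain, if_true, if_false, Bool.false_eq_true] <;>
    split_ifs <;> simp_all [qSigPlus, Fin.ext_iff] <;> omega

theorem qbfMain_bot {v : QV r m} (hv : v ≠ QV.bot) : qbfMain r m lit v QV.bot = ∅ := by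
  cases v <;> simp_all [qbfMain]

theorem mem_qbfDelta_bot {v : QV r m} (hv : v ≠ QV.bot) {u : List (QA r)} :
    u ∈ qbfDelta r m lit v QV.bot ↔ u ≠ [] ∧ ∀ w, u ∉ qbfMain r m lit v w := by
  simp [qbfDelta, hv]

theorem qbfDelta_of_ne_bot {v w : QV r m} (hw : w ≠ QV.bot) :
    qbfDelta r m lit v w = qbfMain r m lit v w := by
  simp [qbfDelta, hw]

theorem qbf_winningFrom_iff {v₀ : QV r m} {σ : List (QV r m) → ℕ → QA r} :
    WinningFrom (qbfDelta r m lit) (qbfSafe r m) v₀ σ ↔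
      ∀ k, 1 ≤ k → ∀ h, ¬ Reach (qbfDelta r m lit) v₀ σ k h QV.bot := by
  rw [winningFrom_iff_reach]
  · refine forall₃_congr fun k _ h => ⟨fun H hr => H _ hr rfl, fun H v hr hv => ?_⟩
    exact H (hv ▸ hr)
  · intro v hv u hu
    obtain rfl : v = QV.bot := by simpa [qbfSafe] using hv
    simpa [qbfDelta, qbfMain, qSigPlus] using hu

/-- Under a winning strategy, every reachable history is extended by a specified transition. -/
theorem exists_reach_step {v₀ : QV r m} {σ : List (QV r m) → ℕ → QA r}
    (hσ : WinningFrom (qbfDelta r m lit) (qbfSafe r m) v₀ σ) {k : ℕ} (hk : 1 ≤ k)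
    {h : List (QV r m)} {v : QV r m} (hr : Reach (qbfDelta r m lit) v₀ σ k h v) :
    ∃ w, wordPrefix (σ h) k ∈ qbfMain r m lit v w ∧
      Reach (qbfDelta r m lit) v₀ σ k (h ++ [w]) w := by
  rw [qbf_winningFrom_iff] at hσ
  have hv : v ≠ QV.bot := by
    rintro rfl
    exact hσ k hk h hr
  by_contra! H
  refine hσ k hk _ (hr.step ((mem_qbfDelta_bot hv).mpr ⟨wordPrefix_ne_nil _ hk, fun w hw => ?_⟩))
  have hwb : w ≠ QV.bot := by
    rintro rfl
    simp [qbfMain_bot hv] at hw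
  exact H w hw (hr.step (by rwa [qbfDelta_of_ne_bot hwb]))

theorem exists_reach_stage_succ (hm : 1 ≤ m) {v₀ : QV r m} {σ : List (QV r m) → ℕ → QA r}
    (hσ : WinningFrom (qbfDelta r m lit) (qbfSafe r m) v₀ σ) {k : ℕ} (hk : 1 ≤ k)
    {h : List (QV r m)} {j : Fin (2 * r)}
    (hr : Reach (qbfDelta r m lit) v₀ σ k h (QV.v j))
    (hj : j.val % 2 = 0 → (prm j ∣ k ↔ σ h 0 = QA.a)) :
    Reach (qbfDelta r m lit) v₀ σ k
      (h ++ [varVertex j (decide (prm j ∣ k))] ++ [stageVertex hm (j + 1)])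
      (stageVertex hm (j + 1)) := by
  obtain ⟨w, hw, hr'⟩ := exists_reach_step hσ hk hr
  have hwe : w = varVertex j (decide (prm j ∣ k)) := by
    cases w with
    | vx i =>
      simp only [qbfMain] at hw
      split_ifs at hw with h1 h2
      · obtain ⟨n, -, hd, hu⟩ := hw
        obtain ⟨rfl, -⟩ := wordPrefix_eq_replicate hk hu
        simp [varVertex, hd, h1]
      · obtain ⟨n, -, hd, hu⟩ := hw
        obtain ⟨rfl, -⟩ := wordPrefix_eq_replicate hk hu
        simp [varVertex, hd, h1]
      · simp at hw
    | vxbar i =>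
      simp only [qbfMain] at hw
      split_ifs at hw with h1 h2
      · obtain ⟨n, -, hd, hu⟩ := hw
        obtain ⟨rfl, -⟩ := wordPrefix_eq_replicate hk hu
        simp [varVertex, hd, h1]
      · obtain ⟨n, -, hd, hu⟩ := hw
        obtain ⟨rfl, -⟩ := wordPrefix_eq_replicate hk hu
        simp [varVertex, hd, h1]
      · simp at hw
    | top =>
      simp only [qbfMain] at hw
      split_ifs at hw with h1
      · rcases hw with ⟨n, -, hd, hu⟩ | ⟨n, -, hd, hu⟩ <;>
        · obtain ⟨rfl, h0⟩ := wordPrefix_eq_replicate hk hu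
          simp [hd, h0] at hj
          omega
      · simp at hw
    | v i => simp [qbfMain] at hw
    | vC i => simp [qbfMain] at hw
    | bot => simp [qbfMain] at hw
  subst hwe
  obtain ⟨w, hw, hr''⟩ := exists_reach_step hσ hk hr'
  obtain ⟨-, rfl⟩ := (mem_qbfMain_varVertex hm).mp hw
  exact hr''

theorem satisfiesMatrix_of_reach (hm : 1 ≤ m) {v₀ : QV r m} {σ : List (QV r m) → ℕ → QA r}
    (hσ : WinningFrom (qbfDelta r m lit) (qbfSafe r m) v₀ σ) {k : ℕ} (hk : 1 ≤ k)
    {h : List (QV r m)} (hr : Reach (qbfDelta r m lit) v₀ σ k h (QV.vC ⟨0, hm⟩)) :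
    SatisfiesMatrix r m lit (fun i => decide (prm i ∣ k)) := by
  have hlit : ∀ {h : List (QV r m)} {c : Fin m},
      wordPrefix (σ h) k ∈ ⋃ jj : Fin 3, litLang r (lit c jj) →
        ∃ j : Fin 3, decide (prm (lit c j).1 ∣ k) = (lit c j).2 := by
    intro h c hu
    obtain ⟨j, n, -, hd, hu⟩ := Set.mem_iUnion.mp hu
    obtain ⟨rfl, -⟩ := wordPrefix_eq_replicate hk hu
    exact ⟨j, by rw [Bool.eq_iff_iff, decide_eq_true_iff, hd]⟩
  have key : ∀ c (hc : c < m), ∃ h, Reach (qbfDelta r m lit) v₀ σ k h (QV.vC ⟨c, hc⟩) := by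
    intro c
    induction c with
    | zero => exact fun _ => ⟨h, hr⟩
    | succ c ih =>
      intro hc
      obtain ⟨h, hr⟩ := ih (by omega)
      obtain ⟨w, hw, hr'⟩ := exists_reach_step hσ hk hr
      cases w with
      | vC d =>
        simp only [qbfMain] at hw
        split_ifs at hw with h1
        · obtain rfl : d = ⟨c + 1, hc⟩ := Fin.ext h1
          exact ⟨_, hr'⟩
        · simp at hw
      | top =>
        simp only [qbfMain] at hw
        split_ifs at hw with h1
        · omega
        · simp at hw
      | _ => simp [qbfMain] at hw
  intro c
  obtain ⟨h, hr⟩ := key c c.isLt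
  obtain ⟨w, hw, -⟩ := exists_reach_step hσ hk hr
  cases w with
  | vC d =>
    simp only [qbfMain] at hw
    split_ifs at hw
    · exact hlit hw
    · simp at hw
  | top =>
    simp only [qbfMain] at hw
    split_ifs at hw
    · exact hlit hw
    · simp at hw
  | _ => simp [qbfMain] at hw

theorem altTrue_of_winning (hm : 1 ≤ m) {v₀ : QV r m} {σ : List (QV r m) → ℕ → QA r}
    (hσ : WinningFrom (qbfDelta r m lit) (qbfSafe r m) v₀ σ) (d : ℕ) (bs : List Bool)
    (hd : bs.length + d = 2 * r)
    (h : List (QV r m)) (hr : ∀ k, 1 ≤ k → primeBits k bs.length = bs →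
      Reach (qbfDelta r m lit) v₀ σ k h (stageVertex hm bs.length)) :
    altTrue (fun bs => SatisfiesMatrix r m lit (fun i => bs.getD i.val false)) d bs := by
  induction d generalizing bs h with
  | zero =>
    obtain ⟨k, hk, hkb⟩ := exists_primeBits_eq bs
    have hr := hr k hk hkb
    have hlen : bs.length = 2 * r := hd
    rw [stageVertex, dif_neg (by omega)] at hr
    have hsat := satisfiesMatrix_of_reach hm hσ hk hr
    show SatisfiesMatrix r m lit (fun i => bs.getD i.val false)
    convert hsat using 2 with i
    rw [← hkb, hlen, getD_primeBits i.isLt]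
  | succ d ih =>
    have hlt : bs.length < 2 * r := by omega
    have next : ∀ b : Bool, (bs.length % 2 = 0 → (b = true ↔ σ h 0 = QA.a)) →
        altTrue (fun bs => SatisfiesMatrix r m lit (fun i => bs.getD i.val false)) d
          (bs ++ [b]) := by
      intro b hb
      refine ih (bs ++ [b]) (by simp; omega)
        (h ++ [varVertex ⟨bs.length, hlt⟩ b] ++ [stageVertex hm (bs.length + 1)])
        fun k hk hkb => ?_
      rw [List.length_append, List.length_singleton, primeBits_succ] at hkb
      obtain ⟨hkbs, hb'⟩ := List.append_inj hkb (length_primeBits _ _)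
      obtain rfl : decide (prm bs.length ∣ k) = b := by simpa using hb'
      have hr := hr k hk hkbs
      rw [stageVertex, dif_pos hlt] at hr
      simpa using exists_reach_stage_succ hm hσ hk hr (by simpa using hb)
    rw [altTrue]
    split_ifs with he
    · classical
      exact ⟨decide (σ h 0 = QA.a), next _ fun _ => by simp⟩
    · exact fun b => next b fun h0 => absurd h0 he

/-- The truth value recorded by a visit of a vertex. -/
def QV.truthValue : QV r m → Option Bool
  | QV.vx _ => some true
  | QV.vxbar _ => some false
  | _ => none

/-- The partial assignment recorded by a history. -/
def histBits (h : List (QV r m)) : List Bool := h.filterMap QV.truthValue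

theorem histBits_append_singleton (h : List (QV r m)) (v : QV r m) :
    histBits (h ++ [v]) = histBits h ++ v.truthValue.toList := by
  cases hv : v.truthValue <;> simp [histBits, hv]

open Classical in
/-- The letter played by the coalition at vertex `v`, given the partial assignment `bs`. -/
noncomputable def qbfLetter (lit : Fin m → Fin 3 → Fin (2 * r) × Bool) (P : List Bool → Prop)
    (bs : List Bool) : QV r m → QA r
  | QV.v j =>
      if j.val % 2 = 0 then
        if altTrue P (2 * r - (j + 1)) (bs ++ [true]) then QA.a else QA.b
      else QA.c
  | QV.vC c =>
      if hc : ∃ j : Fin 3, bs.getD (lit c j).1 false = (lit c j).2 then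
        QA.idx (lit c hc.choose).1
      else QA.a
  | _ => QA.a

/-- The strategy repeating forever the letter `qbfLetter` for the current history. -/
noncomputable def qbfStrategy (lit : Fin m → Fin 3 → Fin (2 * r) × Bool) (P : List Bool → Prop)
    (h : List (QV r m)) : ℕ → QA r :=
  fun _ => qbfLetter lit P (histBits h) (h.getLast?.getD QV.top)

/-- The number of variables already assigned at a vertex, if the play is still undecided. -/
def QV.stage : QV r m → Option ℕ
  | QV.v j => some j
  | QV.vx i => some (i + 1)
  | QV.vxbar i => some (i + 1)
  | QV.vC _ => some (2 * r)
  | _ => none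

/-- The assignment recorded so far is the one encoded by the number of agents, and the
remaining formula is true under it. -/
def OnTrack (P : List Bool → Prop) (k : ℕ) (h : List (QV r m)) (v : QV r m) : Prop :=
  v ≠ QV.bot ∧ ∀ j ∈ v.stage, histBits h = primeBits k j ∧ altTrue P (2 * r - j) (primeBits k j)

theorem qbfLetter_exists {P : List Bool → Prop} {bs : List Bool} {j : Fin (2 * r)}
    (hl : bs.length = j) (hj : j.val % 2 = 0) (h : altTrue P (2 * r - j) bs) :
    (qbfLetter lit P bs (QV.v j) = QA.a ∧ altTrue P (2 * r - (j + 1)) (bs ++ [true])) ∨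
      (qbfLetter lit P bs (QV.v j) = QA.b ∧ altTrue P (2 * r - (j + 1)) (bs ++ [false])) := by
  have hlt := j.isLt
  rw [show 2 * r - j.val = (2 * r - (j + 1)) + 1 by omega, altTrue, if_pos (by rw [hl, hj])] at h
  by_cases ht : altTrue P (2 * r - (j + 1)) (bs ++ [true])
  · simp [qbfLetter, hj, ht]
  · obtain ⟨_ | _, hb⟩ := h
    · simp [qbfLetter, hj, ht, hb]
    · exact absurd hb ht

theorem qbfLetter_forall {P : List Bool → Prop} {bs : List Bool} {j : Fin (2 * r)}
    (hl : bs.length = j) (hj : j.val % 2 ≠ 0) (h : altTrue P (2 * r - j) bs) :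
    qbfLetter lit P bs (QV.v j) = QA.c ∧ ∀ b, altTrue P (2 * r - (j + 1)) (bs ++ [b]) := by
  have hlt := j.isLt
  rw [show 2 * r - j.val = (2 * r - (j + 1)) + 1 by omega, altTrue, if_neg (by rwa [hl])] at h
  exact ⟨by simp [qbfLetter, hj], h⟩

theorem OnTrack.append_varVertex {P : List Bool → Prop} {k : ℕ} {h : List (QV r m)}
    {j : Fin (2 * r)} {b : Bool} (ht : OnTrack P k h (QV.v j)) (hb : decide (prm j ∣ k) = b)
    (ha : altTrue P (2 * r - (j + 1)) (histBits h ++ [b])) :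
    OnTrack P k (h ++ [varVertex j b]) (varVertex j b) := by
  have hbits := (ht.2 j rfl).1
  have hP : primeBits k (j + 1) = histBits h ++ [b] := by rw [primeBits_succ, hb, hbits]
  cases b <;> simpa [OnTrack, varVertex, QV.stage, hP, histBits_append_singleton, QV.truthValue] using ha

theorem onTrack_top {P : List Bool → Prop} {k : ℕ} {h : List (QV r m)} :
    OnTrack P k h QV.top := by simp [OnTrack, QV.stage]

theorem OnTrack.step_v {P : List Bool → Prop} {k : ℕ} (hk : 1 ≤ k) {h : List (QV r m)}
    {j : Fin (2 * r)} {w : QV r m} (ht : OnTrack P k h (QV.v j))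
    (hw : List.replicate k (qbfLetter lit P (histBits h) (QV.v j)) ∈
      qbfDelta r m lit (QV.v j) w) : OnTrack P k (h ++ [w]) w := by
  obtain ⟨hb, ha⟩ := ht.2 j rfl
  rw [← hb] at ha
  have hl : (histBits h).length = j := by rw [hb, length_primeBits]
  have hrep : ∀ (n : ℕ) (x y : QA r),
      List.replicate k x = List.replicate n y ↔ n = k ∧ y = x := by
    intro n x y
    rw [List.replicate_inj]
    constructor
    · rintro ⟨rfl, h0 | rfl⟩
      · omega
      · exact ⟨rfl, rfl⟩
    · rintro ⟨rfl, rfl⟩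
      exact ⟨rfl, Or.inr rfl⟩
  have hx : decide (prm j ∣ k) = true → altTrue P (2 * r - (j + 1)) (histBits h ++ [true]) →
      OnTrack P k (h ++ [QV.vx j]) (QV.vx j) := ht.append_varVertex
  have hxbar : decide (prm j ∣ k) = false → altTrue P (2 * r - (j + 1)) (histBits h ++ [false]) →
      OnTrack P k (h ++ [QV.vxbar j]) (QV.vxbar j) := ht.append_varVertex
  by_cases hwb : w = QV.bot
  · subst hwb
    obtain ⟨-, hw⟩ := (mem_qbfDelta_bot (by simp)).mp hw
    have h1 := hw (QV.vx j)
    have h2 := hw (QV.vxbar j)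
    have h3 := hw QV.top
    by_cases hj : j.val % 2 = 0
    · rcases qbfLetter_exists (lit := lit) hl hj ha with ⟨hc, -⟩ | ⟨hc, -⟩ <;>
        simp_all [qbfMain]
    · obtain ⟨hc, -⟩ := qbfLetter_forall (lit := lit) hl hj ha
      simp_all [qbfMain]
  · rw [qbfDelta_of_ne_bot hwb] at hw
    by_cases hj : j.val % 2 = 0
    · rcases qbfLetter_exists (lit := lit) hl hj ha with ⟨hc, ha'⟩ | ⟨hc, ha'⟩ <;>
        cases w with
        | vx i =>
          by_cases hij : i = j <;> simp_all [qbfMain]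
        | vxbar i =>
          by_cases hij : i = j <;> simp_all [qbfMain]
        | top => exact onTrack_top
        | _ => simp [qbfMain] at hw
    · obtain ⟨hc, ha'⟩ := qbfLetter_forall (lit := lit) hl hj ha
      cases w with
      | vx i =>
        by_cases hij : i = j <;> simp_all [qbfMain]
      | vxbar i =>
        by_cases hij : i = j <;> simp_all [qbfMain]
      | top => exact onTrack_top
      | _ => simp [qbfMain] at hw

theorem OnTrack.step_varVertex (hm : 1 ≤ m) {P : List Bool → Prop} {k : ℕ} {h : List (QV r m)}
    {i : Fin (2 * r)} {b : Bool} {w : QV r m} {u : List (QA r)}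
    (ht : OnTrack P k h (varVertex i b)) (hw : u ∈ qbfDelta r m lit (varVertex i b) w) :
    OnTrack P k (h ++ [w]) w := by
  have hb : (varVertex i b : QV r m) ≠ QV.bot := by cases b <;> simp [varVertex]
  have hs := ht.2 (i + 1) (by cases b <;> simp [varVertex, QV.stage])
  have hi := i.isLt
  have hwb : w ≠ QV.bot := by
    rintro rfl
    obtain ⟨hu, hw⟩ := (mem_qbfDelta_bot hb).mp hw
    exact hw _ ((mem_qbfMain_varVertex hm).mpr ⟨hu, rfl⟩)
  rw [qbfDelta_of_ne_bot hwb] at hw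
  obtain ⟨-, rfl⟩ := (mem_qbfMain_varVertex hm).mp hw
  refine ⟨hwb, ?_⟩
  unfold stageVertex
  split_ifs with hlt
  · simpa [QV.stage, histBits_append_singleton, QV.truthValue] using hs
  · rw [show i.val + 1 = 2 * r by omega] at hs
    simpa [QV.stage, histBits_append_singleton, QV.truthValue] using hs

theorem OnTrack.step_vC {k : ℕ} (hk : 1 ≤ k) {h : List (QV r m)} {c : Fin m} {w : QV r m}
    (ht : OnTrack (fun bs => SatisfiesMatrix r m lit (fun i => bs.getD i.val false)) k h (QV.vC c))
    (hw : List.replicate k (qbfLetter lit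
        (fun bs => SatisfiesMatrix r m lit (fun i => bs.getD i.val false)) (histBits h) (QV.vC c)) ∈
      qbfDelta r m lit (QV.vC c) w) :
    OnTrack (fun bs => SatisfiesMatrix r m lit (fun i => bs.getD i.val false)) k (h ++ [w]) w := by
  have hs := ht.2 (2 * r) rfl
  have hwb : w ≠ QV.bot := by
    rintro rfl
    obtain ⟨-, hw⟩ := (mem_qbfDelta_bot (by simp)).mp hw
    obtain ⟨hbits, hP⟩ := hs
    rw [Nat.sub_self, altTrue, ← hbits] at hP
    have hc := hP c
    have hmem : List.replicate k (qbfLetter lit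
        (fun bs => SatisfiesMatrix r m lit (fun i => bs.getD i.val false)) (histBits h)
        (QV.vC c : QV r m)) ∈ ⋃ jj : Fin 3, litLang r (lit c jj) := by
      rw [qbfLetter, dif_pos hc]
      refine Set.mem_iUnion.mpr ⟨hc.choose, k, hk, ?_, rfl⟩
      rw [← hc.choose_spec]
      simp only [hbits]
      rw [getD_primeBits (Fin.isLt _), decide_eq_true_iff]
    by_cases hcm : c.val = m - 1
    · exact hw QV.top (by simpa only [qbfMain, if_pos hcm] using hmem)
    · exact hw (QV.vC ⟨c + 1, by omega⟩) (by simpa only [qbfMain, if_true] using hmem)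
  rw [qbfDelta_of_ne_bot hwb] at hw
  cases w with
  | vC d => exact ⟨hwb, by simpa [QV.stage, histBits_append_singleton, QV.truthValue] using hs⟩
  | top => exact onTrack_top
  | _ => simp [qbfMain] at hw

theorem onTrack_of_reach (hr : 1 ≤ r) (hm : 1 ≤ m) {k : ℕ} (hk : 1 ≤ k)
    (hφ : qbfTrue r m lit) {h : List (QV r m)} {v : QV r m}
    (hreach : Reach (qbfDelta r m lit) (QV.v ⟨0, by omega⟩) (qbfStrategy lit
      (fun bs => SatisfiesMatrix r m lit (fun i => bs.getD i.val false))) k h v) :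
    OnTrack (fun bs => SatisfiesMatrix r m lit (fun i => bs.getD i.val false)) k h v := by
  induction hreach with
  | start =>
    refine ⟨by simp, fun j hj => ?_⟩
    obtain rfl : 0 = j := by simpa [QV.stage] using hj
    exact ⟨rfl, hφ⟩
  | @step h v w hreach hw ih =>
    unfold qbfStrategy at hw
    rw [wordPrefix_const, hreach.getLast?_eq, Option.getD_some] at hw
    cases v with
    | v j => exact ih.step_v hk hw
    | vx i => exact OnTrack.step_varVertex (b := true) hm ih hw
    | vxbar i => exact OnTrack.step_varVertex (b := false) hm ih hw
    | vC c => exact ih.step_vC hk hw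
    | top =>
      have hwb : w ≠ QV.bot := by
        rintro rfl
        obtain ⟨hu, hw⟩ := (mem_qbfDelta_bot (by simp)).mp hw
        exact hw QV.top hu
      rw [qbfDelta_of_ne_bot hwb] at hw
      cases w with
      | top => exact onTrack_top
      | _ => simp [qbfMain] at hw
    | bot => exact absurd rfl ih.1

end Game

/-- the coalition has a winning strategy from `v₀` in `G_φ` iff `φ` is
true. -/
theorem stmt13 (r m : ℕ) (hr : 1 ≤ r) (hm : 1 ≤ m)
    (lit : Fin m → Fin 3 → Fin (2 * r) × Bool) :
    (∃ σ : List (QV r m) → ℕ → QA r,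
        WinningFrom (qbfDelta r m lit) (qbfSafe r m) (QV.v ⟨0, by omega⟩) σ)
      ↔ qbfTrue r m lit := by
  constructor
  · rintro ⟨σ, hσ⟩
    refine altTrue_of_winning hm hσ (2 * r) [] (by simp) [QV.v ⟨0, by omega⟩] fun k _ _ => ?_
    rw [stageVertex, dif_pos (by simp; omega)]
    exact .start
  · intro hφ
    exact ⟨_, qbf_winningFrom_iff.mpr fun k hk h hreach =>
      (onTrack_of_reach hr hm hk hφ hreach).1 rfl⟩
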